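/- For every integer m ≥ 0 and all real numbers 1 ≤ a ≤ b one has ∫_a^b h₀′(t) Q_m(t) dt ≤ Q_m(a) · (h₀(b) − h₀(a)), and ∫_a^b h₀′(t) h(t) Q_{m−1}(t) dt ≤ 2 Q_m(a) · (h₀(b) − h₀(a)), where Q_{−1} ≡ 1. (Inequalities (3.85) and (3.86) of Lemma 3.8.) -/

import Mathlib

open MeasureTheory

/-- `h(t) = ∫₁^∞ max(t, t₁)⁻¹ h₀′(t₁) dt₁`. -/
noncomputable def hFun (h₀' : ℝ → ℝ) (t : ℝ) : ℝ :=
  ∫ t₁ in Set.Ici (1 : ℝ), (max t t₁)⁻¹ * h₀' t₁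

/-- `Q_m(t) = ∫₁^∞ max(t, t₁)⁻¹ h₀′(t₁) h(t₁)^m dt₁`. -/
noncomputable def QFun (h₀' : ℝ → ℝ) (m : ℕ) (t : ℝ) : ℝ :=
  ∫ t₁ in Set.Ici (1 : ℝ), (max t t₁)⁻¹ * h₀' t₁ * hFun h₀' t₁ ^ m

/-- `Q_{m−1}`, with the convention `Q₋₁ ≡ 1`. -/
noncomputable def QFunPred (h₀' : ℝ → ℝ) : ℕ → ℝ → ℝ
  | 0 => fun _ => 1
  | m + 1 => QFun h₀' m

/-- The kernel `(max t s)⁻¹` is integrable against `w g` when `w` is integrable against `s⁻¹`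
and `g` is nonnegative and nonincreasing. -/
lemma integrable_inv_max_mul {w g : ℝ → ℝ} (hcont : ContinuousOn w (Set.Ici 1))
    (hw : ∀ t ∈ Set.Ici (1 : ℝ), 0 ≤ w t)
    (hint : IntegrableOn (fun t => t⁻¹ * w t) (Set.Ici 1))
    (hg : AntitoneOn g (Set.Ici 1)) (hg0 : ∀ t ∈ Set.Ici (1 : ℝ), 0 ≤ g t) (t : ℝ) :
    IntegrableOn (fun s => (max t s)⁻¹ * w s * g s) (Set.Ici 1) := by
  refine (hint.const_mul (g 1)).mono' ?_ ?_
  · have h1 : Measurable fun s : ℝ => (max t s)⁻¹ := (measurable_const.max measurable_id).inv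
    exact (h1.aestronglyMeasurable.mul (hcont.aestronglyMeasurable measurableSet_Ici)).mul
      (aemeasurable_restrict_of_antitoneOn measurableSet_Ici hg).aestronglyMeasurable
  · filter_upwards [ae_restrict_mem measurableSet_Ici] with s hs
    have hs1 : (1 : ℝ) ≤ s := hs
    have hs0 : (0 : ℝ) < s := by linarith
    have hk : (max t s)⁻¹ ≤ s⁻¹ := inv_anti₀ hs0 (le_max_right t s)
    have hk0 : 0 ≤ (max t s)⁻¹ := inv_nonneg.2 (hs0.le.trans (le_max_right t s))
    have hgs : g s ≤ g 1 := hg Set.self_mem_Ici hs hs1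
    have hws := hw s hs
    have hg0s := hg0 s hs
    rw [Real.norm_of_nonneg (by positivity), mul_comm (g 1)]
    gcongr

lemma inv_max_mul_integral_nonneg {w g : ℝ → ℝ} (hw : ∀ t ∈ Set.Ici (1 : ℝ), 0 ≤ w t)
    (hg0 : ∀ t ∈ Set.Ici (1 : ℝ), 0 ≤ g t) (t : ℝ) :
    0 ≤ ∫ s in Set.Ici (1 : ℝ), (max t s)⁻¹ * w s * g s := by
  refine setIntegral_nonneg measurableSet_Ici fun s hs => ?_
  have hs1 : (1 : ℝ) ≤ s := hs
  have hk : 0 ≤ (max t s)⁻¹ := inv_nonneg.2 ((zero_le_one.trans hs1).trans (le_max_right t s))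
  exact mul_nonneg (mul_nonneg hk (hw s hs)) (hg0 s hs)

lemma antitone_inv_max_mul_integral {w g : ℝ → ℝ} (hcont : ContinuousOn w (Set.Ici 1))
    (hw : ∀ t ∈ Set.Ici (1 : ℝ), 0 ≤ w t)
    (hint : IntegrableOn (fun t => t⁻¹ * w t) (Set.Ici 1))
    (hg : AntitoneOn g (Set.Ici 1)) (hg0 : ∀ t ∈ Set.Ici (1 : ℝ), 0 ≤ g t) :
    Antitone fun t => ∫ s in Set.Ici (1 : ℝ), (max t s)⁻¹ * w s * g s := by
  intro t t' htt'
  refine setIntegral_mono_on (integrable_inv_max_mul hcont hw hint hg hg0 t')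
    (integrable_inv_max_mul hcont hw hint hg hg0 t) measurableSet_Ici fun s hs => ?_
  have hs0 : (0 : ℝ) < s := zero_lt_one.trans_le hs
  have hk : (max t' s)⁻¹ ≤ (max t s)⁻¹ :=
    inv_anti₀ (hs0.trans_le (le_max_right t s)) (max_le_max_right s htt')
  exact mul_le_mul_of_nonneg_right (mul_le_mul_of_nonneg_right hk (hw s hs)) (hg0 s hs)

lemma hFun_eq (w : ℝ → ℝ) (t : ℝ) :
    hFun w t = ∫ s in Set.Ici (1 : ℝ), (max t s)⁻¹ * w s * (fun _ => (1 : ℝ)) s := by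
  simp [hFun]

lemma hFun_nonneg {w : ℝ → ℝ} (hw : ∀ t ∈ Set.Ici (1 : ℝ), 0 ≤ w t) (t : ℝ) : 0 ≤ hFun w t := by
  rw [hFun_eq]
  exact inv_max_mul_integral_nonneg hw (fun _ _ => zero_le_one) t

lemma hFun_antitone {w : ℝ → ℝ} (hcont : ContinuousOn w (Set.Ici 1))
    (hw : ∀ t ∈ Set.Ici (1 : ℝ), 0 ≤ w t)
    (hint : IntegrableOn (fun t => t⁻¹ * w t) (Set.Ici 1)) : Antitone (hFun w) := by
  intro t t' htt'
  rw [hFun_eq, hFun_eq]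
  exact antitone_inv_max_mul_integral hcont hw hint antitoneOn_const
    (fun _ _ => zero_le_one) htt'

lemma hFun_pow_antitone {w : ℝ → ℝ} (hcont : ContinuousOn w (Set.Ici 1))
    (hw : ∀ t ∈ Set.Ici (1 : ℝ), 0 ≤ w t)
    (hint : IntegrableOn (fun t => t⁻¹ * w t) (Set.Ici 1)) (m : ℕ) :
    Antitone fun t => hFun w t ^ m := fun _ t' htt' =>
  pow_le_pow_left₀ (hFun_nonneg hw t') (hFun_antitone hcont hw hint htt') m

lemma QFun_nonneg {w : ℝ → ℝ} (hw : ∀ t ∈ Set.Ici (1 : ℝ), 0 ≤ w t) (m : ℕ) (t : ℝ) :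
    0 ≤ QFun w m t :=
  inv_max_mul_integral_nonneg hw (fun s _ => pow_nonneg (hFun_nonneg hw s) m) t

lemma QFun_antitone {w : ℝ → ℝ} (hcont : ContinuousOn w (Set.Ici 1))
    (hw : ∀ t ∈ Set.Ici (1 : ℝ), 0 ≤ w t)
    (hint : IntegrableOn (fun t => t⁻¹ * w t) (Set.Ici 1)) (m : ℕ) : Antitone (QFun w m) :=
  antitone_inv_max_mul_integral hcont hw hint ((hFun_pow_antitone hcont hw hint m).antitoneOn _)
    fun s _ => pow_nonneg (hFun_nonneg hw s) m

/-- Symmetrization of the double integral, split according to which variable is larger. -/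
lemma hFun_mul_integral_le {w g : ℝ → ℝ} (hcont : ContinuousOn w (Set.Ici 1))
    (hw : ∀ t ∈ Set.Ici (1 : ℝ), 0 ≤ w t)
    (hint : IntegrableOn (fun t => t⁻¹ * w t) (Set.Ici 1))
    (hg : AntitoneOn g (Set.Ici 1)) (hg0 : ∀ t ∈ Set.Ici (1 : ℝ), 0 ≤ g t) {t : ℝ} :
    hFun w t * (∫ s in Set.Ici (1 : ℝ), (max t s)⁻¹ * w s * g s) ≤
      2 * ∫ s in Set.Ici (1 : ℝ), (max t s)⁻¹ * w s * g s * hFun w s := by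
  set μ : Measure ℝ := volume.restrict (Set.Ici (1 : ℝ)) with hμ
  have hQ : Integrable (fun s => (max t s)⁻¹ * w s * g s) μ :=
    integrable_inv_max_mul hcont hw hint hg hg0 t
  have hH : Integrable (fun u => (max t u)⁻¹ * w u) μ := by
    have := integrable_inv_max_mul (g := fun _ => 1) hcont hw hint antitoneOn_const
      (fun _ _ => zero_le_one) t
    simp only [mul_one] at this
    exact this
  have hmem : ∀ᵐ z ∂(μ.prod μ), z.1 ∈ Set.Ici (1 : ℝ) ∧ z.2 ∈ Set.Ici (1 : ℝ) := by
    rw [hμ, Measure.prod_restrict]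
    exact ae_restrict_mem (measurableSet_Ici.prod measurableSet_Ici)
  have hF : Integrable (fun z : ℝ × ℝ =>
      (max t z.1)⁻¹ * w z.1 * g z.1 * ((max t z.2)⁻¹ * w z.2)) (μ.prod μ) := hQ.mul_prod hH
  have hG : Integrable (fun z : ℝ × ℝ =>
      (max t z.1)⁻¹ * w z.1 * g z.1 * ((max z.1 z.2)⁻¹ * w z.2)) (μ.prod μ) := by
    refine (hQ.mul_prod hint).mono' ?_ ?_
    · have h1 : Measurable fun z : ℝ × ℝ => (max z.1 z.2)⁻¹ :=
        (measurable_fst.max measurable_snd).inv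
      have hwm : AEStronglyMeasurable w μ := hcont.aestronglyMeasurable measurableSet_Ici
      exact hQ.aestronglyMeasurable.comp_fst.mul (h1.aestronglyMeasurable.mul hwm.comp_snd)
    · filter_upwards [hmem] with z hz
      obtain ⟨hz1, hz2⟩ := hz
      have h1 : (1 : ℝ) ≤ z.1 := hz1
      have h2 : (1 : ℝ) ≤ z.2 := hz2
      have hk0 : 0 ≤ (max t z.1)⁻¹ :=
        inv_nonneg.2 ((zero_le_one.trans h1).trans (le_max_right _ _))
      have hk1 : 0 ≤ (max z.1 z.2)⁻¹ :=
        inv_nonneg.2 ((zero_le_one.trans h1).trans (le_max_left _ _))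
      have hk : (max z.1 z.2)⁻¹ ≤ z.2⁻¹ := inv_anti₀ (by linarith) (le_max_right _ _)
      have hw1 := hw _ hz1
      have hw2 := hw _ hz2
      have hg1 := hg0 _ hz1
      rw [Real.norm_of_nonneg (by positivity)]
      gcongr
  have hFval : ∫ z, (max t z.1)⁻¹ * w z.1 * g z.1 * ((max t z.2)⁻¹ * w z.2) ∂(μ.prod μ) =
      (∫ s, (max t s)⁻¹ * w s * g s ∂μ) * hFun w t :=
    integral_prod_mul (fun s => (max t s)⁻¹ * w s * g s) (fun u => (max t u)⁻¹ * w u)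
  have hGval : ∫ z, (max t z.1)⁻¹ * w z.1 * g z.1 * ((max z.1 z.2)⁻¹ * w z.2) ∂(μ.prod μ) =
      ∫ s, (max t s)⁻¹ * w s * g s * hFun w s ∂μ := by
    rw [integral_prod _ hG]
    refine integral_congr_ae (Filter.Eventually.of_forall fun s => ?_)
    exact integral_const_mul ((max t s)⁻¹ * w s * g s) fun u => (max s u)⁻¹ * w u
  have hGswap : ∫ z : ℝ × ℝ, (max t z.2)⁻¹ * w z.2 * g z.2 * ((max z.2 z.1)⁻¹ * w z.1)
      ∂(μ.prod μ) =
      ∫ z, (max t z.1)⁻¹ * w z.1 * g z.1 * ((max z.1 z.2)⁻¹ * w z.2) ∂(μ.prod μ) :=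
    integral_prod_swap (μ := μ) (ν := μ) fun z : ℝ × ℝ =>
      (max t z.1)⁻¹ * w z.1 * g z.1 * ((max z.1 z.2)⁻¹ * w z.2)
  rw [mul_comm, ← hFval, two_mul, ← hGval]
  nth_rewrite 2 [← hGswap]
  have hG' : Integrable (fun z : ℝ × ℝ =>
      (max t z.2)⁻¹ * w z.2 * g z.2 * ((max z.2 z.1)⁻¹ * w z.1)) (μ.prod μ) := hG.swap
  rw [← integral_add hG hG']
  refine integral_mono_ae hF (hG.add hG') ?_
  filter_upwards [hmem] with z hz
  obtain ⟨s, u⟩ := z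
  obtain ⟨hs, hu⟩ := hz
  have hs1 : (1 : ℝ) ≤ s := hs
  have hu1 : (1 : ℝ) ≤ u := hu
  have hws := hw _ hs
  have hwu := hw _ hu
  have hgs := hg0 _ hs
  have hgu := hg0 _ hu
  have hts : 0 ≤ (max t s)⁻¹ := inv_nonneg.2 ((zero_le_one.trans hs1).trans (le_max_right _ _))
  have htu : 0 ≤ (max t u)⁻¹ := inv_nonneg.2 ((zero_le_one.trans hu1).trans (le_max_right _ _))
  have hsu : 0 ≤ (max s u)⁻¹ := inv_nonneg.2 ((zero_le_one.trans hs1).trans (le_max_left _ _))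
  dsimp only
  rw [max_comm u s]
  rcases le_total s u with h | h
  · have hk : (max t u)⁻¹ ≤ (max s u)⁻¹ := by
      rw [max_eq_right h]
      exact inv_anti₀ (by linarith) (le_max_right _ _)
    refine le_add_of_le_of_nonneg ?_ (by positivity)
    gcongr
  · have hk : (max t s)⁻¹ ≤ (max s u)⁻¹ := by
      rw [max_eq_left h]
      exact inv_anti₀ (by linarith) (le_max_right _ _)
    have hgg : g s ≤ g u := hg hu hs h
    refine le_add_of_nonneg_of_le (by positivity) ?_
    calc (max t s)⁻¹ * w s * g s * ((max t u)⁻¹ * w u)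
        ≤ (max s u)⁻¹ * w s * g u * ((max t u)⁻¹ * w u) := by gcongr
      _ = (max t u)⁻¹ * w u * g u * ((max s u)⁻¹ * w s) := by ring

lemma QFunPred_nonneg {w : ℝ → ℝ} (hw : ∀ t ∈ Set.Ici (1 : ℝ), 0 ≤ w t) (m : ℕ) (t : ℝ) :
    0 ≤ QFunPred w m t := by
  cases m with
  | zero => exact zero_le_one
  | succ k => exact QFun_nonneg hw k t

lemma hFun_mul_QFunPred_le {w : ℝ → ℝ} (hcont : ContinuousOn w (Set.Ici 1))
    (hw : ∀ t ∈ Set.Ici (1 : ℝ), 0 ≤ w t)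
    (hint : IntegrableOn (fun t => t⁻¹ * w t) (Set.Ici 1)) (m : ℕ) (t : ℝ) :
    hFun w t * QFunPred w m t ≤ 2 * QFun w m t := by
  cases m with
  | zero =>
    have hQ : QFun w 0 t = hFun w t := by simp [QFun, hFun]
    have := hFun_nonneg hw t
    rw [hQ, QFunPred, mul_one]
    linarith
  | succ k =>
    have hQ : QFun w (k + 1) t =
        ∫ s in Set.Ici (1 : ℝ), (max t s)⁻¹ * w s * hFun w s ^ k * hFun w s := by
      simp only [QFun, pow_succ, mul_assoc]
    rw [hQ]
    exact hFun_mul_integral_le hcont hw hint ((hFun_pow_antitone hcont hw hint k).antitoneOn _)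
      fun s _ => pow_nonneg (hFun_nonneg hw s) k

/-- No measurability of `f` is needed: a nonintegrable product has integral zero. -/
lemma integral_deriv_mul_le {h₀ w f : ℝ → ℝ} {a b C : ℝ}
    (hderiv : ∀ t ∈ Set.Ici (1 : ℝ), HasDerivWithinAt h₀ (w t) (Set.Ici 1) t)
    (hcont : ContinuousOn w (Set.Ici 1)) (hw : ∀ t ∈ Set.Ici (1 : ℝ), 0 ≤ w t)
    (ha : 1 ≤ a) (hab : a ≤ b) (hf0 : ∀ t, 0 ≤ f t) (hf : ∀ t, a ≤ t → f t ≤ C) :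
    ∫ t in a..b, w t * f t ≤ C * (h₀ b - h₀ a) := by
  have hsub : Set.Icc a b ⊆ Set.Ici 1 := fun t ht => ha.trans ht.1
  have hwi : IntervalIntegrable w volume a b := by
    apply ContinuousOn.intervalIntegrable
    rw [Set.uIcc_of_le hab]
    exact hcont.mono hsub
  have hftc : ∫ t in a..b, w t = h₀ b - h₀ a := by
    refine intervalIntegral.integral_eq_sub_of_hasDerivAt_of_le hab
      (fun t ht => ((hderiv t (hsub ht)).mono hsub).continuousWithinAt) (fun t ht => ?_) hwi
    have ht1 : 1 < t := ha.trans_lt ht.1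
    exact (hderiv t ht1.le).hasDerivAt (Ici_mem_nhds ht1)
  rw [← hftc, mul_comm, ← intervalIntegral.integral_mul_const,
    intervalIntegral.integral_of_le hab, intervalIntegral.integral_of_le hab]
  refine integral_mono_of_nonneg ?_ (hwi.mul_const C).1 ?_
  · filter_upwards [ae_restrict_mem measurableSet_Ioc] with t ht
    exact mul_nonneg (hw t (hsub (Set.Ioc_subset_Icc_self ht))) (hf0 t)
  · filter_upwards [ae_restrict_mem measurableSet_Ioc] with t ht
    exact mul_le_mul_of_nonneg_left (hf t ht.1.le) (hw t (hsub (Set.Ioc_subset_Icc_self ht)))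

/-- Inequalities (3.85) and (3.86) of Lemma 3.8: for `m ≥ 0` and `1 ≤ a ≤ b`,
`∫_a^b h₀′(t) Q_m(t) dt ≤ Q_m(a) (h₀(b) − h₀(a))` and
`∫_a^b h₀′(t) h(t) Q_{m−1}(t) dt ≤ 2 Q_m(a) (h₀(b) − h₀(a))`, where `Q₋₁ ≡ 1`. -/
theorem stmt15 (h₀ h₀' : ℝ → ℝ)
    (hderiv : ∀ t ∈ Set.Ici (1 : ℝ), HasDerivWithinAt h₀ (h₀' t) (Set.Ici 1) t)
    (hcont : ContinuousOn h₀' (Set.Ici 1))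
    (h₀nonneg : ∀ t ∈ Set.Ici (1 : ℝ), 0 ≤ h₀ t)
    (h₀'nonneg : ∀ t ∈ Set.Ici (1 : ℝ), 0 ≤ h₀' t)
    (hint₀ : IntegrableOn (fun t => (t ^ 2)⁻¹ * h₀ t) (Set.Ici 1))
    (hint' : IntegrableOn (fun t => t⁻¹ * h₀' t) (Set.Ici 1))
    (m : ℕ) (a b : ℝ) (ha : 1 ≤ a) (hab : a ≤ b) :
    (∫ t in a..b, h₀' t * QFun h₀' m t) ≤ QFun h₀' m a * (h₀ b - h₀ a) ∧
    (∫ t in a..b, h₀' t * (hFun h₀' t * QFunPred h₀' m t)) ≤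
      2 * QFun h₀' m a * (h₀ b - h₀ a) := by
  have hQ := QFun_antitone hcont h₀'nonneg hint' m
  constructor
  · exact integral_deriv_mul_le hderiv hcont h₀'nonneg ha hab (QFun_nonneg h₀'nonneg m)
      fun t ht => hQ ht
  · refine integral_deriv_mul_le hderiv hcont h₀'nonneg ha hab
      (fun t => mul_nonneg (hFun_nonneg h₀'nonneg t) (QFunPred_nonneg h₀'nonneg m t))
      fun t ht => (hFun_mul_QFunPred_le hcont h₀'nonneg hint' m t).trans ?_
    exact mul_le_mul_of_nonneg_left (hQ ht) zero_le_two
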